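/- There is an absolute constant C such that for every real x ≥ 2, ∑ 1/(q·ε(q)) ≤ C·(log x)/x, where the sum is over odd squarefree positive integers q with x/2 < ε(q) ≤ x. Consequently the series ∑ 1/(q·ε(q)), over all odd squarefree positive integers q, converges. -/

import Mathlib

open Finset in
theorem sum_rpow_neg_one_sub_le {s : ℝ} (hs : 0 < s) (v : Finset ℕ) :
    ∑ n ∈ v, (n : ℝ) ^ (-1 - s) ≤ 1 + 1 / s := by
  have step (x : ℝ) (hx : 0 < x) :
      (x + 1) ^ (-1 - s) ≤ x ^ (-s) / s - (x + 1) ^ (-s) / s := by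
    have hx1 : 0 < x + 1 := by linarith
    have hlog : 1 / (x + 1) ≤ Real.log (x + 1) - Real.log x := by
      have h := Real.log_le_sub_one_of_pos (div_pos hx hx1)
      rw [Real.log_div hx.ne' hx1.ne'] at h
      have : x / (x + 1) - 1 = -(1 / (x + 1)) := by field_simp; ring
      linarith
    have hratio : x ^ (-s) = (x + 1) ^ (-s) * Real.exp (s * (Real.log (x + 1) - Real.log x)) := by
      rw [Real.rpow_def_of_pos hx, Real.rpow_def_of_pos hx1, ← Real.exp_add]
      ring_nf
    have hexp : 1 + s / (x + 1) ≤ Real.exp (s * (Real.log (x + 1) - Real.log x)) := by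
      have h1 := Real.add_one_le_exp (s * (Real.log (x + 1) - Real.log x))
      have h2 := mul_le_mul_of_nonneg_left hlog hs.le
      rw [mul_one_div] at h2
      linarith
    have hpos : 0 < (x + 1) ^ (-s) := Real.rpow_pos_of_pos hx1 _
    have hsplit : (x + 1) ^ (-1 - s) = (x + 1) ^ (-s) / (x + 1) := by
      rw [show -1 - s = -s - 1 by ring, Real.rpow_sub_one hx1.ne']
    have h3 := mul_le_mul_of_nonneg_left hexp hpos.le
    rw [← hratio] at h3
    rw [hsplit, ← sub_div, le_div_iff₀ hs]
    calc (x + 1) ^ (-s) / (x + 1) * s = (x + 1) ^ (-s) * (1 + s / (x + 1)) - (x + 1) ^ (-s) := by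
          ring
      _ ≤ _ := by linarith
  have partial_sum (M : ℕ) : ∑ n ∈ range (M + 2), (n : ℝ) ^ (-1 - s) ≤
      1 + 1 / s - ((M : ℝ) + 1) ^ (-s) / s := by
    induction M with
    | zero =>
      have : -1 - s ≠ 0 := by linarith
      simp [sum_range_succ, Real.zero_rpow this]
    | succ M ih =>
      rw [show M + 1 + 2 = (M + 2) + 1 by ring, sum_range_succ]
      have := step ((M : ℝ) + 1) (by positivity)
      push_cast
      rw [show (M : ℝ) + 2 = M + 1 + 1 by ring]
      linarith
  obtain ⟨M, hM⟩ := v.exists_nat_subset_range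
  calc ∑ n ∈ v, (n : ℝ) ^ (-1 - s) ≤ ∑ n ∈ range (M + 2), (n : ℝ) ^ (-1 - s) :=
        sum_le_sum_of_subset_of_nonneg (hM.trans (range_mono (by omega)))
          fun _ _ _ ↦ by positivity
    _ ≤ 1 + 1 / s - ((M : ℝ) + 1) ^ (-s) / s := partial_sum M
    _ ≤ 1 + 1 / s := sub_le_self _ (by positivity)

open Finset in
theorem prod_one_add_rpow_le {s : ℝ} (hs : 0 < s) {T : Finset ℕ} (hT : ∀ p ∈ T, p.Prime) :
    ∏ p ∈ T, (1 + (p : ℝ) ^ (-1 - s)) ≤ 1 + 1 / s := by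
  have hinj : Set.InjOn (fun t : Finset ℕ ↦ ∏ p ∈ t, p) T.powerset := by
    intro t ht t' ht' h
    rw [mem_coe, mem_powerset] at ht ht'
    rw [← Nat.primeFactors_prod fun p hp ↦ hT p (ht hp),
      ← Nat.primeFactors_prod fun p hp ↦ hT p (ht' hp)]
    exact congrArg Nat.primeFactors h
  rw [prod_one_add]
  calc ∑ t ∈ T.powerset, ∏ p ∈ t, (p : ℝ) ^ (-1 - s)
      = ∑ t ∈ T.powerset, ((∏ p ∈ t, p : ℕ) : ℝ) ^ (-1 - s) := by
        refine sum_congr rfl fun t _ ↦ ?_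
        rw [Nat.cast_prod, Real.finsetProd_rpow _ _ fun _ _ ↦ Nat.cast_nonneg _]
    _ = ∑ n ∈ T.powerset.image fun t ↦ ∏ p ∈ t, p, (n : ℝ) ^ (-1 - s) :=
        (sum_image (f := fun n : ℕ ↦ (n : ℝ) ^ (-1 - s)) hinj).symm
    _ ≤ 1 + 1 / s := sum_rpow_neg_one_sub_le hs _

open Finset in
theorem sum_inv_le_prod_one_add_inv {u T : Finset ℕ} (hu : ∀ q ∈ u, Squarefree q)
    (hT : ∀ q ∈ u, q.primeFactors ⊆ T) :
    ∑ q ∈ u, 1 / (q : ℝ) ≤ ∏ p ∈ T, (1 + 1 / (p : ℝ)) := by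
  have hinj : Set.InjOn Nat.primeFactors u := by
    intro q hq q' hq' h
    rw [← Nat.prod_primeFactors_of_squarefree (hu q hq),
      ← Nat.prod_primeFactors_of_squarefree (hu q' hq'), h]
  rw [prod_one_add]
  calc ∑ q ∈ u, 1 / (q : ℝ) = ∑ q ∈ u, ∏ p ∈ q.primeFactors, 1 / (p : ℝ) := by
        refine sum_congr rfl fun q hq ↦ ?_
        conv_lhs => rw [← Nat.prod_primeFactors_of_squarefree (hu q hq)]
        simp
    _ = ∑ t ∈ u.image Nat.primeFactors, ∏ p ∈ t, 1 / (p : ℝ) :=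
        (sum_image (f := fun t : Finset ℕ ↦ ∏ p ∈ t, 1 / (p : ℝ)) hinj).symm
    _ ≤ _ := sum_le_sum_of_subset_of_nonneg
        (image_subset_iff.2 fun q hq ↦ mem_powerset.2 (hT q hq)) fun _ _ _ ↦ by positivity

open Finset in
theorem prod_primesLE_pow_div_dvd_factorial (N : ℕ) :
    ∏ p ∈ Nat.primesLE N, p ^ (N / p) ∣ N.factorial := by
  refine prod_dvd_of_isRelPrime (fun p hp p' hp' hne ↦ ?_) fun p hp ↦ ?_
  · exact Nat.coprime_iff_isRelPrime.1 <| Nat.coprime_pow_primes _ _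
      (Nat.mem_primesLE.1 hp).2 (Nat.mem_primesLE.1 hp').2 hne
  · have hprime := (Nat.mem_primesLE.1 hp).2
    rw [hprime.pow_dvd_factorial_iff (by omega : Nat.log p N < Nat.log p N + 2)]
    simpa using single_le_sum (f := fun i ↦ N / p ^ i) (fun _ _ ↦ Nat.zero_le _)
      (mem_Ico.2 ⟨le_rfl, by omega⟩ : 1 ∈ Ico 1 (Nat.log p N + 2))

open Finset in
theorem sum_log_div_prime_le {N : ℕ} (hN : 1 ≤ N) :
    ∑ p ∈ Nat.primesLE N, Real.log p / p ≤ Real.log N + Real.log 4 := by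
  have hN0 : (0 : ℝ) < N := by exact_mod_cast hN
  have hfac : ∑ p ∈ Nat.primesLE N, ((N / p : ℕ) : ℝ) * Real.log p ≤ N * Real.log N := by
    have hle := (Nat.le_of_dvd N.factorial_pos (prod_primesLE_pow_div_dvd_factorial N)).trans
      N.factorial_le_pow
    have hprime (p : ℕ) (hp : p ∈ Nat.primesLE N) : ((p : ℝ) ^ (N / p)) ≠ 0 :=
      pow_ne_zero _ (by exact_mod_cast (Nat.mem_primesLE.1 hp).2.ne_zero)
    have hpos : (0 : ℝ) < ∏ p ∈ Nat.primesLE N, (p : ℝ) ^ (N / p) :=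
      lt_of_le_of_ne (by positivity) (prod_ne_zero_iff.2 hprime).symm
    have := Real.log_le_log hpos (by exact_mod_cast hle : _ ≤ (N : ℝ) ^ N)
    rw [Real.log_prod hprime, Real.log_pow] at this
    simpa [Real.log_pow] using this
  have htheta : ∑ p ∈ Nat.primesLE N, Real.log p ≤ Real.log 4 * N := by
    rw [← Chebyshev.theta_eq_sum_primesLE_log]
    exact Chebyshev.theta_le_log4_mul_x hN0.le
  have hterm (p : ℕ) (hp : p ∈ Nat.primesLE N) :
      N * (Real.log p / p) ≤ ((N / p : ℕ) : ℝ) * Real.log p + Real.log p := by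
    have hlt : (N : ℝ) / p ≤ ((N / p : ℕ) : ℝ) + 1 := by
      rw [← Nat.floor_div_eq_div (K := ℝ)]
      exact (Nat.lt_floor_add_one _).le
    calc N * (Real.log p / p) = N / p * Real.log p := by ring
      _ ≤ (((N / p : ℕ) : ℝ) + 1) * Real.log p :=
        mul_le_mul_of_nonneg_right hlt (Real.log_natCast_nonneg p)
      _ = _ := by ring
  refine le_of_mul_le_mul_left ?_ hN0
  rw [mul_sum]
  refine (sum_le_sum hterm).trans ?_
  rw [sum_add_distrib]
  linarith

open Finset in
theorem prod_primesLE_one_add_inv_le {N : ℕ} (hN : 2 ≤ N) :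
    ∏ p ∈ Nat.primesLE N, (1 + 1 / (p : ℝ)) ≤ Real.exp 3 * (1 + Real.log N) := by
  have hlog2 : 0 < Real.log 2 := Real.log_pos one_lt_two
  have hlog : Real.log 2 ≤ Real.log N := Real.log_le_log two_pos (by exact_mod_cast hN)
  set s := (Real.log N)⁻¹ with hs_def
  have hs : 0 < s := inv_pos.2 (hlog2.trans_le hlog)
  have hterm (p : ℕ) (hp : p ∈ Nat.primesLE N) :
      1 + 1 / (p : ℝ) ≤ (1 + (p : ℝ) ^ (-1 - s)) * (1 + s * (Real.log p / p)) := by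
    have hp0 : (0 : ℝ) < p := by exact_mod_cast (Nat.mem_primesLE.1 hp).2.pos
    have hpow : (p : ℝ) ^ (-1 - s) = 1 / p * Real.exp (-(s * Real.log p)) := by
      rw [Real.rpow_sub hp0, Real.rpow_neg_one, Real.rpow_def_of_pos hp0, Real.exp_neg]
      ring_nf
    have hexp := mul_le_mul_of_nonneg_left (Real.add_one_le_exp (-(s * Real.log p)))
      (one_div_pos.2 hp0).le
    rw [← hpow] at hexp
    have hl : 0 ≤ s * (Real.log p / p) :=
      mul_nonneg hs.le (div_nonneg (Real.log_natCast_nonneg p) hp0.le)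
    have hr : 0 ≤ (p : ℝ) ^ (-1 - s) := by positivity
    have : 1 / (p : ℝ) * (-(s * Real.log p) + 1) = 1 / p - s * (Real.log p / p) := by ring
    nlinarith [mul_nonneg hr hl]
  have hsum : s * ∑ p ∈ Nat.primesLE N, Real.log p / p ≤ 3 := by
    have h4 : Real.log 4 = 2 * Real.log 2 := by
      rw [show (4 : ℝ) = 2 ^ 2 by norm_num, Real.log_pow]; norm_num
    rw [hs_def, inv_mul_le_iff₀ (hlog2.trans_le hlog)]
    linarith [sum_log_div_prime_le (by omega : 1 ≤ N)]
  calc ∏ p ∈ Nat.primesLE N, (1 + 1 / (p : ℝ))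
      ≤ ∏ p ∈ Nat.primesLE N, ((1 + (p : ℝ) ^ (-1 - s)) * (1 + s * (Real.log p / p))) :=
        prod_le_prod (fun _ _ ↦ by positivity) hterm
    _ = (∏ p ∈ Nat.primesLE N, (1 + (p : ℝ) ^ (-1 - s))) *
        ∏ p ∈ Nat.primesLE N, (1 + s * (Real.log p / p)) := prod_mul_distrib
    _ ≤ (1 + 1 / s) * Real.exp (∑ p ∈ Nat.primesLE N, s * (Real.log p / p)) := by
        gcongr
        · exact prod_one_add_rpow_le hs fun p hp ↦ (Nat.mem_primesLE.1 hp).2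
        · exact Real.prod_one_add_le_exp_sum _ fun p ↦
            mul_nonneg hs.le (div_nonneg (Real.log_natCast_nonneg p) p.cast_nonneg)
    _ ≤ (1 + 1 / s) * Real.exp 3 := by
        rw [← mul_sum]
        gcongr
    _ = Real.exp 3 * (1 + Real.log N) := by rw [hs_def, one_div, inv_inv]; ring

open Finset in
theorem prod_one_add_inv_le_of_card_le {N : ℕ} (hN : 2 ≤ N) {T : Finset ℕ}
    (hT : ∀ p ∈ T, p.Prime) (hcard : T.card ≤ N) :
    ∏ p ∈ T, (1 + 1 / (p : ℝ)) ≤ Real.exp 4 * (1 + Real.log N) := by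
  have hN0 : (0 : ℝ) < N := by positivity
  have hlarge : ∏ p ∈ T with ¬ p ≤ N, (1 + 1 / (p : ℝ)) ≤ Real.exp 1 := by
    refine (Real.prod_one_add_le_exp_sum _ fun _ ↦ by positivity).trans (Real.exp_le_exp.2 ?_)
    calc ∑ p ∈ T with ¬ p ≤ N, 1 / (p : ℝ) ≤ #{p ∈ T | ¬ p ≤ N} • (1 / (N : ℝ)) := by
          refine sum_le_card_nsmul _ _ _ fun p hp ↦ ?_
          have : (N : ℝ) ≤ p := by exact_mod_cast (not_le.1 (mem_filter.1 hp).2).le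
          exact one_div_le_one_div_of_le hN0 this
      _ ≤ N • (1 / (N : ℝ)) := by
          gcongr
          exact (card_filter_le _ _).trans hcard
      _ = 1 := by rw [nsmul_eq_mul, mul_one_div_cancel hN0.ne']
  have hsmall : ∏ p ∈ T with p ≤ N, (1 + 1 / (p : ℝ)) ≤ Real.exp 3 * (1 + Real.log N) := by
    refine le_trans ?_ (prod_primesLE_one_add_inv_le hN)
    refine prod_le_prod_of_subset_of_one_le (fun p hp ↦ ?_) (fun _ _ ↦ by positivity)
      fun _ _ _ ↦ le_add_of_nonneg_right (by positivity)
    exact Nat.mem_primesLE.2 ⟨(mem_filter.1 hp).2, hT p (mem_filter.1 hp).1⟩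
  rw [← prod_filter_mul_prod_filter_not T (· ≤ N)]
  calc _ ≤ Real.exp 3 * (1 + Real.log N) * Real.exp 1 := by
        gcongr
    _ = Real.exp 4 * (1 + Real.log N) := by
        rw [show (4 : ℝ) = 3 + 1 by norm_num, Real.exp_add]; ring

open Finset in
/-- All primes modulo which `2` has order at most `X` divide `∏ n ≤ X, (2 ^ n - 1)`, so there are
at most `X ^ 2` of them. -/
theorem card_primeFactors_prod_two_pow_sub_one_le (X : ℕ) :
    #(∏ n ∈ Icc 1 X, (2 ^ n - 1)).primeFactors ≤ X ^ 2 := by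
  set D := ∏ n ∈ Icc 1 X, (2 ^ n - 1)
  have hD : 0 < D := prod_pos fun n hn ↦
    Nat.sub_pos_of_lt (Nat.one_lt_two_pow (by have := mem_Icc.1 hn; omega))
  refine (Nat.pow_le_pow_iff_right one_lt_two).1 ?_
  calc 2 ^ #D.primeFactors ≤ ∏ p ∈ D.primeFactors, p :=
        pow_card_le_prod _ _ _ fun p hp ↦ (Nat.prime_of_mem_primeFactors hp).two_le
    _ ≤ D := Nat.le_of_dvd hD D.prod_primeFactors_dvd
    _ ≤ ∏ n ∈ Icc 1 X, 2 ^ X := prod_le_prod' fun n hn ↦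
        (Nat.sub_le _ _).trans (Nat.pow_le_pow_right two_pos (mem_Icc.1 hn).2)
    _ = 2 ^ X ^ 2 := by simp [← pow_mul, sq]

theorem orderOf_two_zmod_pos {q : ℕ} (hq : Odd q) : 0 < orderOf (2 : ZMod q) := by
  have : NeZero q := ⟨hq.pos.ne'⟩
  have h : IsUnit ((2 : ℕ) : ZMod q) :=
    (ZMod.isUnit_iff_coprime 2 q).2 (Nat.coprime_two_left.2 hq)
  exact orderOf_pos_iff.2 (by simpa using isOfFinOrder_iff_isUnit.2 h)

theorem dvd_two_pow_orderOf_sub_one (q : ℕ) : q ∣ 2 ^ orderOf (2 : ZMod q) - 1 := by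
  rw [← ZMod.natCast_eq_zero_iff, Nat.cast_sub Nat.one_le_two_pow]
  simp [pow_orderOf_eq_one]

open Finset in
theorem sum_inv_le_of_orderOf_le {X : ℕ} (hX : 1 ≤ X) {u : Finset ℕ}
    (hu : ∀ q ∈ u, Odd q ∧ Squarefree q ∧ orderOf (2 : ZMod q) ≤ X) :
    ∑ q ∈ u, 1 / (q : ℝ) ≤ 2 * Real.exp 4 * (1 + Real.log X) := by
  have hX0 : (X : ℝ) ≠ 0 := by positivity
  set D := ∏ n ∈ Icc 1 X, (2 ^ n - 1)
  have hD0 : D ≠ 0 := prod_ne_zero_iff.2 fun n hn ↦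
    (Nat.sub_pos_of_lt (Nat.one_lt_two_pow (by have := mem_Icc.1 hn; omega))).ne'
  have hsub (q : ℕ) (hq : q ∈ u) : q.primeFactors ⊆ D.primeFactors :=
    Nat.primeFactors_mono ((dvd_two_pow_orderOf_sub_one q).trans <|
      dvd_prod_of_mem (fun n ↦ 2 ^ n - 1)
        (mem_Icc.2 ⟨orderOf_two_zmod_pos (hu q hq).1, (hu q hq).2.2⟩)) hD0
  have hcard : #D.primeFactors ≤ 2 * X ^ 2 :=
    (card_primeFactors_prod_two_pow_sub_one_le X).trans (by omega)
  refine (sum_inv_le_prod_one_add_inv (fun q hq ↦ (hu q hq).2.1) hsub).trans ?_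
  refine (prod_one_add_inv_le_of_card_le (by nlinarith)
    (fun p hp ↦ Nat.prime_of_mem_primeFactors hp) hcard).trans ?_
  have hlog : Real.log ((2 * X ^ 2 : ℕ) : ℝ) = Real.log 2 + 2 * Real.log X := by
    push_cast
    rw [Real.log_mul two_ne_zero (pow_ne_zero _ hX0), Real.log_pow]
    norm_num
  have hlog2 := Real.log_two_lt_d9
  rw [hlog, mul_comm 2 (Real.exp 4), mul_assoc]
  exact mul_le_mul_of_nonneg_left (by linarith) (Real.exp_nonneg 4)

open Finset in
theorem sum_inv_mul_orderOf_le {x : ℝ} (hx : 1 ≤ x) {u : Finset ℕ}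
    (hu : ∀ q ∈ u, Odd q ∧ Squarefree q ∧ x / 2 < (orderOf (2 : ZMod q) : ℝ) ∧
      (orderOf (2 : ZMod q) : ℝ) ≤ x) :
    ∑ q ∈ u, 1 / ((q : ℝ) * (orderOf (2 : ZMod q) : ℝ)) ≤
      4 * Real.exp 4 * (1 + Real.log x) / x := by
  have hx0 : 0 < x := by linarith
  have hfloor : 1 ≤ ⌊x⌋₊ := Nat.one_le_floor_iff x |>.2 hx
  have hsum := sum_inv_le_of_orderOf_le hfloor (u := u) fun q hq ↦
    ⟨(hu q hq).1, (hu q hq).2.1, Nat.le_floor (hu q hq).2.2.2⟩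
  have hlog : Real.log ⌊x⌋₊ ≤ Real.log x :=
    Real.log_le_log (by exact_mod_cast hfloor) (Nat.floor_le hx0.le)
  calc ∑ q ∈ u, 1 / ((q : ℝ) * (orderOf (2 : ZMod q) : ℝ))
      ≤ ∑ q ∈ u, 1 / (q : ℝ) * (2 / x) := by
        refine sum_le_sum fun q hq ↦ ?_
        have h := one_div_le_one_div_of_le (by positivity) (hu q hq).2.2.1.le
        rw [one_div_div] at h
        rw [← one_div_mul_one_div]
        exact mul_le_mul_of_nonneg_left h (by positivity)
    _ = (∑ q ∈ u, 1 / (q : ℝ)) * (2 / x) := (sum_mul _ _ _).symm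
    _ ≤ 2 * Real.exp 4 * (1 + Real.log x) * (2 / x) := by
        gcongr
        exact hsum.trans (by gcongr)
    _ = 4 * Real.exp 4 * (1 + Real.log x) / x := by ring

theorem summable_succ_div_two_pow : Summable fun k : ℕ ↦ ((k : ℝ) + 1) / 2 ^ k := by
  have h1 := summable_pow_mul_geometric_of_norm_lt_one 1 (r := (1 / 2 : ℝ)) (by norm_num)
  have h0 := summable_pow_mul_geometric_of_norm_lt_one 0 (r := (1 / 2 : ℝ)) (by norm_num)
  refine (h1.add h0).congr fun k ↦ ?_
  rw [one_div, inv_pow]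
  ring

open Finset in
theorem sum_inv_mul_orderOf_le_tsum {u : Finset ℕ} (hu : ∀ q ∈ u, Odd q ∧ Squarefree q) :
    ∑ q ∈ u, 1 / ((q : ℝ) * (orderOf (2 : ZMod q) : ℝ)) ≤
      4 * Real.exp 4 * ∑' k : ℕ, ((k : ℝ) + 1) / 2 ^ k := by
  set c : ℕ → ℕ := fun q ↦ Nat.clog 2 (orderOf (2 : ZMod q))
  have hfiber (k : ℕ) : ∑ q ∈ u with c q = k, 1 / ((q : ℝ) * (orderOf (2 : ZMod q) : ℝ)) ≤
      4 * Real.exp 4 * (((k : ℝ) + 1) / 2 ^ k) := by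
    have hpow : (1 : ℝ) ≤ 2 ^ k := one_le_pow₀ one_le_two
    refine (sum_inv_mul_orderOf_le hpow fun q hq ↦ ?_).trans ?_
    · obtain ⟨hqu, rfl⟩ := mem_filter.1 hq
      have hpos := orderOf_two_zmod_pos (hu q hqu).1
      have hlt : 2 ^ c q < 2 * orderOf (2 : ZMod q) := by
        rcases Nat.eq_zero_or_pos (c q) with h0 | h0
        · rw [h0]; omega
        · have : 2 ^ (c q - 1) < orderOf (2 : ZMod q) :=
            (Nat.lt_clog_iff_pow_lt one_lt_two).1 (Nat.sub_one_lt h0.ne')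
          rw [← Nat.succ_pred_eq_of_pos h0, pow_succ, Nat.pred_eq_sub_one]
          omega
      have hle : orderOf (2 : ZMod q) ≤ 2 ^ c q := Nat.le_pow_clog one_lt_two _
      refine ⟨(hu q hqu).1, (hu q hqu).2, ?_, by exact_mod_cast hle⟩
      have : (2 : ℝ) ^ c q < 2 * (orderOf (2 : ZMod q) : ℝ) := by exact_mod_cast hlt
      linarith
    · have hlog : Real.log (2 ^ k) ≤ k := by
        rw [Real.log_pow]
        exact mul_le_of_le_one_right k.cast_nonneg (by linarith [Real.log_two_lt_d9])
      rw [← mul_div_assoc, add_comm (k : ℝ)]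
      gcongr
  rw [← sum_fiberwise_of_maps_to fun q hq ↦ mem_image_of_mem c hq]
  refine (sum_le_sum fun k _ ↦ hfiber k).trans ?_
  rw [← mul_sum]
  gcongr
  exact summable_succ_div_two_pow.sum_le_tsum _ fun k _ ↦ by positivity

open Classical in
/-- Estimate (26) of the paper: `∑_{x/2 < ε(q) ≤ x} μ²(q)/(q·ε(q)) ≪ (log x)/x` over odd
squarefree `q`, where `ε(q)` is the multiplicative order of `2` mod `q`; consequently the
series `∑ μ²(q)/(q ε(q))` over all odd squarefree `q` converges. -/
theorem sum_inv_q_mul_order_bound :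
    (∃ C : ℝ, 0 < C ∧ ∀ x : ℝ, 2 ≤ x →
      (∑ᶠ q : ℕ, if Odd q ∧ Squarefree q ∧ x / 2 < (orderOf (2 : ZMod q) : ℝ) ∧
          (orderOf (2 : ZMod q) : ℝ) ≤ x then
          1 / ((q : ℝ) * (orderOf (2 : ZMod q) : ℝ)) else 0) ≤ C * Real.log x / x) ∧
    Summable (fun q : ℕ => if Odd q ∧ Squarefree q then
      1 / ((q : ℝ) * (orderOf (2 : ZMod q) : ℝ)) else 0) := by
  refine ⟨⟨12 * Real.exp 4, by positivity, fun x hx ↦ ?_⟩, ?_⟩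
  · have hlog2 : Real.log 2 ≤ Real.log x := Real.log_le_log two_pos hx
    have hlog : 1 / 2 < Real.log x := by linarith [Real.log_two_gt_d9]
    set f : ℕ → ℝ := fun q ↦ if Odd q ∧ Squarefree q ∧ x / 2 < (orderOf (2 : ZMod q) : ℝ) ∧
      (orderOf (2 : ZMod q) : ℝ) ≤ x then 1 / ((q : ℝ) * (orderOf (2 : ZMod q) : ℝ)) else 0
    by_cases hfin : f.support.Finite
    · rw [finsum_eq_sum f hfin, ← Finset.sum_filter]
      refine (sum_inv_mul_orderOf_le (by linarith) fun q hq ↦ (Finset.mem_filter.1 hq).2).trans ?_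
      gcongr ?_ / x
      rw [show 12 * Real.exp 4 * Real.log x = 4 * Real.exp 4 * (3 * Real.log x) by ring]
      gcongr
      linarith
    · rw [finsum_of_infinite_support hfin]
      have : 0 ≤ Real.log x := by linarith
      positivity
  · refine summable_of_sum_le (c := 4 * Real.exp 4 * ∑' k : ℕ, ((k : ℝ) + 1) / 2 ^ k)
      (fun q ↦ ?_) fun u ↦ ?_
    · dsimp only
      split_ifs <;> simp only [Pi.zero_apply] <;> positivity
    · rw [← Finset.sum_filter]
      exact sum_inv_mul_orderOf_le_tsum fun q hq ↦ (Finset.mem_filter.1 hq).2
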